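/- arXiv:1705.03815 — 4 statements merged into one kernel-verified Lean document; each statement's English description precedes it below -/
import Mathlib

section
/- Let G be a group. Let Λ_i = (V_i, E_i, s_i, t_i) and Λ_j = (V_j, E_j, s_j, t_j) be finite oriented graphs (V, E finite types, s, t : E → V). Let ι⁰ : V_i → V_j and φ : E_i → List E_j be such that for each e ∈ E_i the list φ(e) is nonempty and is a path from ι⁰(s_i(e)) to ι⁰(t_i(e)), i.e. s_j of the first entry equals ι⁰(s_i(e)), t_j of the last entry equals ι⁰(t_i(e)), and for consecutive entries the target of one equals the source of the next. Define R : (E_j → G) → (E_i → G) by R(a)(e) = the ordered product of a over φ(e), and let the gauge group G^V act on G^E by (g · a)(e) = g(s(e)) * a(e) * (g(t(e)))⁻¹. Then for all g : V_j → G and a : E_j → G one has R(g · a) = (g ∘ ι⁰) · R(a). -/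
/-- Along a nonempty path the intermediate gauge factors cancel, so the ordered product of a
gauge-transformed configuration only changes by the factors at the two endpoints. -/
theorem List.prod_map_gauge_of_isChain {G V E : Type*} [Group G] (s t : E → V) (g : V → G)
    (a : E → G) (l : List E) (hl : l.IsChain fun f f' => t f = s f') (hne : l ≠ []) :
    (l.map fun f => g (s f) * a f * (g (t f))⁻¹).prod =
      g (s (l.head hne)) * (l.map a).prod * (g (t (l.getLast hne)))⁻¹ := by
  induction l with
  | nil => exact absurd rfl hne
  | cons f l ih =>
    cases l with
    | nil => simp
    | cons f' l =>
      rw [List.isChain_cons_cons] at hl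
      rw [List.map_cons, List.prod_cons, ih hl.2 (List.cons_ne_nil f' l), hl.1]
      simp [mul_assoc]

/-- Equivariance of the refinement map with respect to the gauge group actions:
if each edge `e` of the coarser graph is sent to a nonempty path `φ e` in the finer
graph from `ι0 (si e)` to `ι0 (ti e)`, then `R (g · a) = (g ∘ ι0) · R a`. -/
theorem refinement_map_gauge_equivariant
    {G : Type*} [Group G]
    {Vi Ei Vj Ej : Type*} [Fintype Vi] [Fintype Ei] [Fintype Vj] [Fintype Ej]
    (si ti : Ei → Vi) (sj tj : Ej → Vj)
    (ι0 : Vi → Vj) (φ : Ei → List Ej)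
    (hne : ∀ e, φ e ≠ [])
    (hhead : ∀ e, (φ e).head?.map sj = some (ι0 (si e)))
    (hlast : ∀ e, (φ e).getLast?.map tj = some (ι0 (ti e)))
    (hchain : ∀ e, (φ e).Chain' fun f f' => tj f = sj f') :
    ∀ (g : Vj → G) (a : Ej → G),
      (fun e : Ei => ((φ e).map fun f => g (sj f) * a f * (g (tj f))⁻¹).prod)
        = fun e : Ei =>
            (g ∘ ι0) (si e) * ((φ e).map a).prod * ((g ∘ ι0) (ti e))⁻¹ := by
  intro g a
  funext e
  have hh := hhead e
  have ht := hlast e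
  rw [List.head?_eq_some_head (hne e), Option.map_some, Option.some_inj] at hh
  rw [List.getLast?_eq_some_getLast (hne e), Option.map_some, Option.some_inj] at ht
  rw [List.prod_map_gauge_of_isChain sj tj g a (φ e) (hchain e) (hne e), hh, ht]
  rfl
end

section
/- Let H be a complex Hilbert space, let (ι, ≤) be a directed preorder, and let K : ι → closed subspaces of H be monotone (i ≤ j implies K_i ⊆ K_j) with ⋃_i K_i dense in H. Let p_i denote the orthogonal projection of H onto K_i. Then for every compact operator T on H and every ε > 0 there exist an index i and a compact operator S on H with p_i ∘ S ∘ p_i = S and ‖T − S‖ ≤ ε; equivalently, the set of compact operators S satisfying p_i ∘ S ∘ p_i = S for some i is dense (in operator norm) in the set of all compact operators on H. -/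
open Metric

/-- If the ranges of the star projections `P i` form a directed family with dense union, then
every compact operator `A` is, up to `ε`, unchanged by composing with `P i` on the left, for all
large `i`. -/
theorem IsCompactOperator.exists_forall_norm_one_sub_comp_le
    {H : Type*} [NormedAddCommGroup H] [InnerProductSpace ℂ H] [CompleteSpace H]
    {ι : Type*} [Preorder ι] [IsDirected ι (· ≤ ·)] [Nonempty ι]
    {K : ι → Submodule ℂ H} (hmono : Monotone K) (hdense : Dense (⋃ i, (K i : Set H)))
    {P : ι → H →L[ℂ] H} (hP : ∀ i, IsStarProjection (P i))
    (hrange : ∀ i, Set.range (P i) = (K i : Set H))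
    {A : H →L[ℂ] H} (hA : IsCompactOperator A) {ε : ℝ} (hε : 0 < ε) :
    ∃ i, ∀ j, i ≤ j → ‖(1 - P j) * A‖ ≤ ε := by
  have hmono' : Monotone fun i => thickening ε (K i : Set H) := fun i j hij =>
    thickening_subset_of_subset ε (hmono hij)
  obtain ⟨i, hi⟩ := (IsCompactOperator.isCompact_closure_image_closedBall
      (f := (A : H →ₗ[ℂ] H)) hA 1).elim_directed_cover
    (fun i => thickening ε (K i : Set H)) (fun i => isOpen_thickening)
    (fun y _ => by
      obtain ⟨z, hz, hyz⟩ := hdense.exists_dist_lt y hε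
      obtain ⟨i, hi⟩ := Set.mem_iUnion.1 hz
      exact Set.mem_iUnion.2 ⟨i, mem_thickening_iff.2 ⟨z, hi, hyz⟩⟩)
    hmono'.directed_le
  refine ⟨i, fun j hij => ContinuousLinearMap.opNorm_le_of_unit_norm hε.le fun x hx => ?_⟩
  have hAx : A x ∈ thickening ε (K j : Set H) :=
    hmono' hij (hi (subset_closure ⟨x, by simp [hx], rfl⟩))
  obtain ⟨z, hz, hxz⟩ := mem_thickening_iff.1 hAx
  rw [← hrange j] at hz
  obtain ⟨w, rfl⟩ := hz
  have hPP : P j (P j w) = P j w := DFunLike.congr_fun (hP j).isIdempotentElem.eq w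
  calc ‖((1 - P j) * A) x‖ = ‖(1 - P j) (A x - P j w)‖ := by simp [hPP]
    _ ≤ ‖1 - P j‖ * ‖A x - P j w‖ := (1 - P j).le_opNorm _
    _ ≤ 1 * ‖A x - P j w‖ := by gcongr; exact (hP j).one_sub.norm_le
    _ ≤ ε := by rw [one_mul, ← dist_eq_norm]; exact hxz.le


/-- If `(K i)` is a monotone family of closed subspaces of a complex Hilbert space `H`
indexed by a directed preorder, with dense union, and `P i` is the orthogonal projection
onto `K i` (a self-adjoint idempotent with range `K i`), then every compact operator on
`H` can be approximated in operator norm by compact operators `S` with `P i ∘ S ∘ P i = S`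
for some index `i`. -/
theorem compact_operator_approx_by_corner
    {H : Type*} [NormedAddCommGroup H] [InnerProductSpace ℂ H] [CompleteSpace H]
    {ι : Type*} [Preorder ι] [IsDirected ι (· ≤ ·)] [Nonempty ι]
    (K : ι → Submodule ℂ H)
    (hclosed : ∀ i, IsClosed (K i : Set H))
    (hmono : Monotone K)
    (hdense : Dense (⋃ i, (K i : Set H)))
    (P : ι → H →L[ℂ] H)
    (hidem : ∀ i, IsIdempotentElem (P i))
    (hsa : ∀ i, IsSelfAdjoint (P i))
    (hrange : ∀ i, Set.range (P i) = (K i : Set H)) :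
    ∀ T : H →L[ℂ] H, IsCompactOperator (⇑T) →
      ∀ ε : ℝ, 0 < ε →
        ∃ (i : ι) (S : H →L[ℂ] H),
          IsCompactOperator (⇑S) ∧ (P i) ∘L S ∘L (P i) = S ∧ ‖T - S‖ ≤ ε := by
  intro T hT ε hε
  have hP : ∀ i, IsStarProjection (P i) := fun i => ⟨hidem i, hsa i⟩
  obtain ⟨i₁, h₁⟩ := hT.exists_forall_norm_one_sub_comp_le hmono hdense hP hrange (half_pos hε)
  have hTT : IsCompactOperator (star T * T) := hT.clm_comp (star T)
  obtain ⟨i₂, h₂⟩ := hTT.exists_forall_norm_one_sub_comp_le hmono hdense hP hrange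
    (pow_pos (half_pos hε) 2)
  obtain ⟨i, hi₁, hi₂⟩ := exists_ge_ge i₁ i₂
  have hleft := h₁ i hi₁
  have hQ := (hP i).one_sub
  have hright : ‖T * (1 - P i)‖ ≤ ε / 2 := by
    refine le_of_sq_le_sq ?_ (half_pos hε).le
    calc ‖T * (1 - P i)‖ ^ 2 = ‖(1 - P i) * (star T * T) * (1 - P i)‖ := by
          rw [sq, ← CStarRing.norm_star_mul_self, star_mul, hQ.isSelfAdjoint.star_eq]
          simp only [mul_assoc]
      _ ≤ ‖(1 - P i) * (star T * T)‖ * ‖1 - P i‖ := norm_mul_le _ _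
      _ ≤ (ε / 2) ^ 2 * 1 := by
          gcongr
          exacts [h₂ i hi₂, hQ.norm_le]
      _ = (ε / 2) ^ 2 := mul_one _
  have hPP : P i * P i = P i := hidem i
  refine ⟨i, P i * T * P i, (hT.clm_comp (P i)).comp_clm (P i), ?_, ?_⟩
  · change P i * ((P i * T * P i) * P i) = P i * T * P i
    simp only [mul_assoc, hPP]
    simp only [← mul_assoc, hPP]
  · calc ‖T - P i * T * P i‖ = ‖(1 - P i) * T + P i * (T * (1 - P i))‖ := by
          congr 1; noncomm_ring
      _ ≤ ‖(1 - P i) * T‖ + ‖P i‖ * ‖T * (1 - P i)‖ :=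
          (norm_add_le _ _).trans (by gcongr; exact norm_mul_le _ _)
      _ ≤ ε / 2 + 1 * (ε / 2) := by
          gcongr
          exact (hP i).norm_le
      _ = ε := by ring
end

section
/- Let H be a complex Hilbert space and let T be a densely defined unbounded operator on H (a linear map defined on a dense subspace Dom(T) ⊆ H) that is self-adjoint, i.e. T equals its adjoint T*. Let K be a closed subspace of H with orthogonal projection p, and suppose that p maps Dom(T) into Dom(T) and that T(p x) = p(T x) for every x ∈ Dom(T). Then T maps Dom(T) ∩ K into K, the subspace Dom(T) ∩ K is dense in K, and the restriction of T to Dom(T) ∩ K, viewed as a densely defined unbounded operator on the Hilbert space K, is self-adjoint. -/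
/-- The part of a partially defined operator `T` in a submodule `K`: the restriction of `T` to
`Dom T ∩ K`, as an operator on `K`, when `T` maps `Dom T ∩ K` into `K`. -/
def LinearPMap.partIn {R M : Type*} [Ring R] [AddCommGroup M] [Module R M]
    (T : M →ₗ.[R] M) (K : Submodule R M) (hT : ∀ x : T.domain, (x : M) ∈ K → T x ∈ K) :
    K →ₗ.[R] K where
  domain := T.domain.comap K.subtype
  toFun := LinearMap.codRestrict K
    (T.toFun ∘ₗ K.subtype.restrict (p := T.domain.comap K.subtype) (q := T.domain)
      fun _ hx => hx)
    fun x => hT ⟨((x : K) : M), x.2⟩ (x : K).2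

theorem LinearPMap.coe_partIn_apply {R M : Type*} [Ring R] [AddCommGroup M] [Module R M]
    (T : M →ₗ.[R] M) (K : Submodule R M) (hT : ∀ x : T.domain, (x : M) ∈ K → T x ∈ K)
    (y : (T.partIn K hT).domain) (hy : ((y : K) : M) ∈ T.domain) :
    ((T.partIn K hT y : K) : M) = T ⟨((y : K) : M), hy⟩ :=
  rfl

/-- Reduction of a self-adjoint densely defined operator `T` to a closed invariant
subspace `K`: if the orthogonal projection `p` onto `K` maps `Dom T` into `Dom T` and
commutes with `T` on `Dom T`, then `T` maps `Dom T ∩ K` into `K`, `Dom T ∩ K` is dense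
in `K`, and the restriction of `T` to `Dom T ∩ K`, viewed as a densely defined operator
on the Hilbert space `K`, is self-adjoint. -/
theorem reduction_of_selfAdjoint_unbounded_operator
    {H : Type*} [NormedAddCommGroup H] [InnerProductSpace ℂ H] [CompleteSpace H]
    (T : H →ₗ.[ℂ] H) (hdense : Dense (T.domain : Set H))
    (hsa : T.adjoint = T)
    (K : Submodule ℂ H) (hK : IsClosed (K : Set H))
    (p : H →L[ℂ] H) (hidem : IsIdempotentElem p) (hpsa : IsSelfAdjoint p)
    (hrange : Set.range p = (K : Set H))
    (hpdom : ∀ x : T.domain, p x ∈ T.domain)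
    (hpcomm : ∀ x : T.domain, T ⟨p x, hpdom x⟩ = p (T x)) :
    (∀ x : T.domain, (x : H) ∈ K → T x ∈ K) ∧
    Dense {y : K | (y : H) ∈ T.domain} ∧
    ∃ T' : K →ₗ.[ℂ] K,
      (∀ y : K, y ∈ T'.domain ↔ (y : H) ∈ T.domain) ∧
      (∀ (y : T'.domain) (hy : ((y : K) : H) ∈ T.domain),
        ((T' y : K) : H) = T ⟨((y : K) : H), hy⟩) ∧
      (letI : CompleteSpace K := hK.completeSpace_coe
       T'.adjoint = T') := by
  have hmem (x : H) : p x ∈ K := hrange.subset ⟨x, rfl⟩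
  have hfix {x : H} (hx : x ∈ K) : p x = x := by
    obtain ⟨z, rfl⟩ := hrange.superset hx
    exact congrArg (fun f : H →L[ℂ] H => f z) hidem
  have hsymm (x y : H) : inner ℂ (p x) y = inner ℂ x (p y) := hpsa.isSymmetric x y
  have hinv (x : T.domain) (hx : (x : H) ∈ K) : T x ∈ K := by
    have hpx : (⟨p x, hpdom x⟩ : T.domain) = x := Subtype.ext (hfix hx)
    have h := hpcomm x
    rw [hpx] at h
    exact h ▸ hmem (T x)
  have hdenseK : Dense {y : K | (y : H) ∈ T.domain} := by
    let q : H → K := fun x => ⟨p x, hmem x⟩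
    have hq : Function.Surjective q := fun y => ⟨y, Subtype.ext (hfix y.2)⟩
    refine (hq.denseRange.dense_image (by fun_prop) hdense).mono ?_
    rintro _ ⟨x, hx, rfl⟩
    exact hpdom ⟨x, hx⟩
  have hTsymm : T.IsFormalAdjoint T := by
    simpa only [hsa] using LinearPMap.adjoint_isFormalAdjoint hdense
  refine ⟨hinv, hdenseK, T.partIn K hinv, fun _ => Iff.rfl, T.coe_partIn_apply K hinv, ?_⟩
  let _ : CompleteSpace K := hK.completeSpace_coe
  have hdense' : Dense ((T.partIn K hinv).domain : Set K) := hdenseK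
  have hle : T.partIn K hinv ≤ (T.partIn K hinv).adjoint :=
    LinearPMap.IsFormalAdjoint.le_adjoint hdense' fun x y =>
      hTsymm ⟨((x : K) : H), x.2⟩ ⟨((y : K) : H), y.2⟩
  refine (LinearPMap.eq_of_le_of_domain_eq hle (le_antisymm hle.1 fun y hy => ?_)).symm
  change (y : H) ∈ T.domain
  rw [← hsa]
  refine LinearPMap.mem_adjoint_domain_of_exists _
    ⟨(((T.partIn K hinv).adjoint ⟨y, hy⟩ : K) : H), fun x => ?_⟩
  have h : inner ℂ (((T.partIn K hinv).adjoint ⟨y, hy⟩ : K) : H) (p x) =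
      inner ℂ (y : H) (T ⟨p x, hpdom x⟩) :=
    LinearPMap.adjoint_isFormalAdjoint hdense' ⟨y, hy⟩ ⟨⟨p x, hmem x⟩, hpdom x⟩
  rwa [hpcomm, ← hsymm, ← hsymm, hfix (Subtype.prop _), hfix y.2] at h
end

section
/- Let X be a compact Hausdorff topological space and μ a finite regular (Radon) Borel measure on X with full support. Then the closure, in operator norm, of the set { T_h | h : X × X → ℂ continuous } of integral operators (T_h ψ)(x) = ∫_X h(y, x) ψ(y) dμ(y) on L²(X, μ; ℂ) equals the set of all compact operators on L²(X, μ; ℂ). -/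
open MeasureTheory

section Hilbert

variable {𝕜 E F : Type*} [RCLike 𝕜]
  [NormedAddCommGroup E] [InnerProductSpace 𝕜 E] [NormedAddCommGroup F] [InnerProductSpace 𝕜 F]

open InnerProductSpace

theorem isCompactOperator_rankOne (x : E) (y : F) :
    IsCompactOperator (rankOne 𝕜 x y : F →L[𝕜] E) := by
  rw [rankOne_def']
  exact (isCompactOperator_of_locallyCompactSpace_rng
    (ContinuousLinearMap.toSpanSingleton 𝕜 x)).comp_clm (innerSL 𝕜 y)

theorem continuous_rankOne :
    Continuous fun p : E × F => (rankOne 𝕜 p.1 p.2 : F →L[𝕜] E) :=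
  (ContinuousLinearMap.smulRightL 𝕜 F E).continuous₂.comp
    (((innerSL 𝕜).continuous.comp continuous_snd).prodMk continuous_fst)

/-- Projecting a continuous linear map onto a finite-dimensional subspace yields a sum of
rank-one operators. -/
theorem starProjection_comp_mem_span_rankOne [CompleteSpace E] [CompleteSpace F]
    (V : Submodule 𝕜 E) [FiniteDimensional 𝕜 V] (T : F →L[𝕜] E) :
    V.starProjection ∘L T ∈
      Submodule.span 𝕜 (Set.range fun p : E × F => (rankOne 𝕜 p.1 p.2 : F →L[𝕜] E)) := by
  have hsum : V.starProjection ∘L T = ∑ i, (rankOne 𝕜 (stdOrthonormalBasis 𝕜 V i : E)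
      (T.adjoint (stdOrthonormalBasis 𝕜 V i : E)) : F →L[𝕜] E) := by
    rw [(stdOrthonormalBasis 𝕜 V).starProjection_eq_sum_rankOne]
    ext z
    simp [ContinuousLinearMap.adjoint_inner_left]
  rw [hsum]
  exact Submodule.sum_mem _ fun i _ => Submodule.subset_span ⟨(_, _), rfl⟩

/-- On Hilbert spaces, compact operators are operator-norm limits of finite sums of rank-one
operators. -/
theorem IsCompactOperator.mem_topologicalClosure_span_rankOne [CompleteSpace E] [CompleteSpace F]
    {T : F →L[𝕜] E} (hT : IsCompactOperator T) :
    T ∈ (Submodule.span 𝕜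
      (Set.range fun p : E × F => (rankOne 𝕜 p.1 p.2 : F →L[𝕜] E))).topologicalClosure := by
  rw [← SetLike.mem_coe, Submodule.topologicalClosure_coe, Metric.mem_closure_iff]
  intro ε hε
  obtain ⟨K, hK, hTK⟩ := IsCompactOperator.image_closedBall_subset_compact
    (f := (T : F →ₗ[𝕜] E)) hT 1
  obtain ⟨t, ht, htK⟩ := Metric.totallyBounded_iff.1 hK.totallyBounded (ε / 2) (half_pos hε)
  have : FiniteDimensional 𝕜 (Submodule.span 𝕜 t) := FiniteDimensional.span_of_finite 𝕜 ht
  refine ⟨_, starProjection_comp_mem_span_rankOne (Submodule.span 𝕜 t) T, ?_⟩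
  rw [dist_eq_norm]
  refine lt_of_le_of_lt ?_ (half_lt_self hε)
  refine ContinuousLinearMap.opNorm_le_of_unit_norm (half_pos hε).le fun z hz => ?_
  have hz' : T z ∈ K := hTK ⟨z, by simp [hz], rfl⟩
  obtain ⟨y, hy, hyz⟩ := Set.mem_iUnion₂.1 (htK hz')
  have hmin := Submodule.starProjection_minimal (U := Submodule.span 𝕜 t) (T z)
  rw [sub_apply, ContinuousLinearMap.comp_apply, hmin]
  refine (ciInf_le ⟨0, ?_⟩ (⟨y, Submodule.subset_span hy⟩ : Submodule.span 𝕜 t)).trans ?_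
  · rintro _ ⟨x, rfl⟩
    exact norm_nonneg _
  · rw [← dist_eq_norm]
    exact (Metric.mem_ball.1 hyz).le

end Hilbert

section ProductKernels

variable {X Y 𝕜 : Type*} [TopologicalSpace X] [TopologicalSpace Y] [RCLike 𝕜]

/-- The kernel `(y, x) ↦ f y * g x`. -/
def ContinuousMap.tensor (f : C(X, 𝕜)) (g : C(Y, 𝕜)) : C(X × Y, 𝕜) :=
  f.comp ContinuousMap.fst * g.comp ContinuousMap.snd

theorem ContinuousMap.exists_apply_ne (𝕜 : Type*) [RCLike 𝕜] [T35Space X] {a b : X} (hab : a ≠ b) :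
    ∃ f : C(X, 𝕜), f a ≠ f b := by
  obtain ⟨f, hf, hfab⟩ := separatesPoints_continuous_of_t35Space hab
  exact ⟨⟨fun x => (f x : 𝕜), RCLike.continuous_ofReal.comp hf⟩, by simpa using hfab⟩

/-- Finite sums of product kernels are uniformly dense in the continuous kernels. -/
theorem ContinuousMap.topologicalClosure_span_tensor [CompactSpace X] [CompactSpace Y]
    [T2Space X] [T2Space Y] :
    (Submodule.span 𝕜 (Set.range fun p : C(X, 𝕜) × C(Y, 𝕜) =>
      p.1.tensor p.2)).topologicalClosure = ⊤ := by
  set M : Submonoid C(X × Y, 𝕜) :=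
    { carrier := Set.range fun p : C(X, 𝕜) × C(Y, 𝕜) => p.1.tensor p.2
      one_mem' := ⟨(1, 1), by ext; simp [tensor]⟩
      mul_mem' := by
        rintro _ _ ⟨p, rfl⟩ ⟨q, rfl⟩
        exact ⟨(p.1 * q.1, p.2 * q.2), by ext; simp [tensor]; ring⟩ } with hM
  have hspan : Submodule.span 𝕜 (Set.range fun p : C(X, 𝕜) × C(Y, 𝕜) => p.1.tensor p.2) =
      Subalgebra.toSubmodule (Algebra.adjoin 𝕜 (M : Set C(X × Y, 𝕜))) := by
    rw [Algebra.adjoin_eq_span, Submonoid.closure_eq]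
    rfl
  have hstar : star (M : Set C(X × Y, 𝕜)) = M := by
    have hsub : ∀ x ∈ M, star x ∈ M := by
      rintro _ ⟨p, rfl⟩
      exact ⟨(star p.1, star p.2), by ext; simp [tensor]⟩
    ext x
    exact ⟨fun hx => by simpa using hsub _ hx, hsub x⟩
  have hdense := ContinuousMap.starSubalgebra_topologicalClosure_eq_top_of_separatesPoints
    (𝕜 := 𝕜) (StarAlgebra.adjoin 𝕜 (M : Set C(X × Y, 𝕜))) (by
      rintro ⟨x, y⟩ ⟨x', y'⟩ hne
      have hmem : ∀ p : C(X, 𝕜) × C(Y, 𝕜),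
          p.1.tensor p.2 ∈ StarAlgebra.adjoin 𝕜 (M : Set C(X × Y, 𝕜)) :=
        fun p => StarAlgebra.subset_adjoin 𝕜 _ ⟨p, rfl⟩
      by_cases hx : x = x'
      · obtain ⟨f, hf⟩ := ContinuousMap.exists_apply_ne 𝕜 fun hy => hne (Prod.ext hx hy)
        exact ⟨_, ⟨_, hmem (1, f), rfl⟩, by simpa [tensor] using hf⟩
      · obtain ⟨f, hf⟩ := ContinuousMap.exists_apply_ne 𝕜 hx
        exact ⟨_, ⟨_, hmem (f, 1), rfl⟩, by simpa [tensor] using hf⟩)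
  have hcoe : ((StarAlgebra.adjoin 𝕜 (M : Set C(X × Y, 𝕜)) : StarSubalgebra 𝕜 C(X × Y, 𝕜)) :
      Set C(X × Y, 𝕜)) = Algebra.adjoin 𝕜 (M : Set C(X × Y, 𝕜)) := by
    rw [← StarSubalgebra.coe_toSubalgebra, StarAlgebra.adjoin_toSubalgebra, hstar, Set.union_self]
  rw [hspan]
  apply SetLike.coe_injective
  have h := congrArg (fun S : StarSubalgebra 𝕜 C(X × Y, 𝕜) => (S : Set C(X × Y, 𝕜))) hdense
  rw [StarSubalgebra.topologicalClosure_coe, hcoe] at h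
  exact h

end ProductKernels

section KernelOperator

variable {X : Type*} [TopologicalSpace X] [CompactSpace X]
  [MeasurableSpace X] (μ : Measure X) [IsFiniteMeasure μ]

variable {μ} in
theorem norm_integral_smul_curry_le (h : C(X × X, ℂ)) (ψ : Lp ℂ 2 μ) :
    ‖∫ y, ψ y • h.curry y ∂μ‖ ≤ μ.real Set.univ ^ (1 / 2 : ℝ) * ‖h‖ * ‖ψ‖ := by
  have hψ : Integrable ψ μ := (Lp.memLp ψ).integrable one_le_two
  have hL1 : ∫ y, ‖ψ y‖ ∂μ ≤ ‖ψ‖ * μ.real Set.univ ^ (1 / 2 : ℝ) := by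
    have hle := eLpNorm_le_eLpNorm_mul_rpow_measure_univ (p := 1) (q := 2) one_le_two
      (Lp.aestronglyMeasurable ψ)
    rw [eLpNorm_one_eq_lintegral_enorm] at hle
    rw [integral_norm_eq_lintegral_enorm (Lp.aestronglyMeasurable ψ), Lp.norm_def, Measure.real,
      ENNReal.toReal_rpow, ← ENNReal.toReal_mul]
    norm_num only [ENNReal.toReal_one, ENNReal.toReal_ofNat] at hle
    refine ENNReal.toReal_mono (ENNReal.mul_ne_top (Lp.eLpNorm_ne_top ψ) ?_) hle
    exact ENNReal.rpow_ne_top_of_nonneg (by norm_num) (measure_ne_top μ _)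
  calc ‖∫ y, ψ y • h.curry y ∂μ‖ ≤ ∫ y, ‖ψ y‖ * ‖h‖ ∂μ := by
        refine norm_integral_le_of_norm_le (hψ.norm.mul_const _) ?_
        refine Filter.Eventually.of_forall fun y => ?_
        rw [norm_smul]
        gcongr
        exact (ContinuousMap.norm_le _ (norm_nonneg h)).2 fun x => h.norm_coe_le_norm (y, x)
    _ = (∫ y, ‖ψ y‖ ∂μ) * ‖h‖ := integral_mul_const _ _
    _ ≤ (‖ψ‖ * μ.real Set.univ ^ (1 / 2 : ℝ)) * ‖h‖ := by gcongr
    _ = _ := by ring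

variable [BorelSpace X]

variable {μ} in
theorem integrable_smul_curry (h : C(X × X, ℂ)) (ψ : Lp ℂ 2 μ) :
    Integrable (fun y => ψ y • h.curry y) μ := by
  have hψ : Integrable ψ μ := (Lp.memLp ψ).integrable one_le_two
  refine hψ.smul_bdd ‖h‖ ?_ ?_
  · exact (h.curry.continuous.stronglyMeasurable_of_hasCompactSupport
      (HasCompactSupport.of_compactSpace _)).aestronglyMeasurable
  · refine Filter.Eventually.of_forall fun y => ?_
    exact (ContinuousMap.norm_le _ (norm_nonneg h)).2 fun x => h.norm_coe_le_norm (y, x)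

variable {μ} in
theorem integral_smul_curry_apply (h : C(X × X, ℂ)) (ψ : Lp ℂ 2 μ) (x : X) :
    (∫ y, ψ y • h.curry y ∂μ) x = ∫ y, h (y, x) * ψ y ∂μ := by
  rw [ContinuousMap.integral_apply (integrable_smul_curry h ψ)]
  simp [mul_comm]

/-- The integral operator on `L²` with a continuous kernel, as a continuous linear function of the
kernel. -/
noncomputable def kernelOperator : C(X × X, ℂ) →L[ℂ] Lp ℂ 2 μ →L[ℂ] Lp ℂ 2 μ :=
  LinearMap.mkContinuous₂
    (LinearMap.mk₂ ℂ
      (fun h ψ => ContinuousMap.toLp 2 μ ℂ (∫ y, ψ y • h.curry y ∂μ))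
      (fun h k ψ => by
        rw [← map_add]
        congr 1
        rw [← integral_add (integrable_smul_curry h ψ) (integrable_smul_curry k ψ)]
        simp_rw [← smul_add]
        rfl)
      (fun c h ψ => by
        rw [← map_smul]
        congr 1
        rw [← integral_smul]
        simp_rw [smul_comm c]
        rfl)
      (fun h ψ φ => by
        rw [← map_add, ← integral_add (integrable_smul_curry h ψ) (integrable_smul_curry h φ)]
        congr 1
        refine integral_congr_ae ?_
        filter_upwards [Lp.coeFn_add ψ φ] with y hy
        rw [hy, Pi.add_apply, add_smul])
      (fun c h ψ => by
        rw [← map_smul, ← integral_smul]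
        congr 1
        refine integral_congr_ae ?_
        filter_upwards [Lp.coeFn_smul c ψ] with y hy
        rw [hy, Pi.smul_apply, smul_assoc]))
    (‖(ContinuousMap.toLp 2 μ ℂ : C(X, ℂ) →L[ℂ] Lp ℂ 2 μ)‖ * μ.real Set.univ ^ (1 / 2 : ℝ))
    (fun h ψ => by
      rw [LinearMap.mk₂_apply]
      refine (ContinuousLinearMap.le_opNorm _ _).trans ?_
      rw [mul_assoc, mul_assoc, ← mul_assoc (μ.real _ ^ _)]
      gcongr
      exact norm_integral_smul_curry_le h ψ)

theorem kernelOperator_apply (h : C(X × X, ℂ)) (ψ : Lp ℂ 2 μ) :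
    kernelOperator μ h ψ = ContinuousMap.toLp 2 μ ℂ (∫ y, ψ y • h.curry y ∂μ) := rfl

theorem coeFn_kernelOperator (h : C(X × X, ℂ)) (ψ : Lp ℂ 2 μ) :
    kernelOperator μ h ψ =ᵐ[μ] fun x => ∫ y, h (y, x) * ψ y ∂μ := by
  rw [kernelOperator_apply]
  filter_upwards [ContinuousMap.coeFn_toLp (p := 2) (𝕜 := ℂ) μ (∫ y, ψ y • h.curry y ∂μ)]
    with x hx
  rw [hx, integral_smul_curry_apply]

theorem kernelOperator_tensor (f g : C(X, ℂ)) :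
    kernelOperator μ (f.tensor g) = InnerProductSpace.rankOne ℂ
      (ContinuousMap.toLp 2 μ ℂ g) (ContinuousMap.toLp 2 μ ℂ (star f)) := by
  ext1 ψ
  rw [kernelOperator_apply, InnerProductSpace.rankOne_apply, ← map_smul]
  congr 1
  ext x
  have hinner : inner ℂ (ContinuousMap.toLp 2 μ ℂ (star f)) ψ = ∫ y, f y * ψ y ∂μ := by
    rw [L2.inner_def]
    refine integral_congr_ae ?_
    filter_upwards [ContinuousMap.coeFn_toLp (p := 2) (𝕜 := ℂ) μ (star f)] with y hy
    rw [hy]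
    simp [mul_comm]
  rw [integral_smul_curry_apply, hinner, ContinuousMap.smul_apply, smul_eq_mul,
    ← integral_mul_const]
  refine integral_congr_ae (Filter.Eventually.of_forall fun y => ?_)
  simp [ContinuousMap.tensor]
  ring

theorem setOf_integral_operators_eq_range_kernelOperator :
    {T : Lp ℂ 2 μ →L[ℂ] Lp ℂ 2 μ |
        ∃ h : X × X → ℂ, Continuous h ∧
          ∀ ψ : Lp ℂ 2 μ, (T ψ : X → ℂ) =ᵐ[μ] fun x => ∫ y, h (y, x) * ψ y ∂μ}
      = Set.range (kernelOperator μ) := by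
  ext T
  constructor
  · rintro ⟨h, hc, hT⟩
    refine ⟨⟨h, hc⟩, ?_⟩
    ext1 ψ
    exact Lp.ext ((coeFn_kernelOperator μ ⟨h, hc⟩ ψ).trans (hT ψ).symm)
  · rintro ⟨h, rfl⟩
    exact ⟨h, h.continuous, coeFn_kernelOperator μ h⟩

theorem isCompactOperator_kernelOperator [T2Space X] (h : C(X × X, ℂ)) :
    IsCompactOperator (kernelOperator μ h) := by
  set K := (compactOperator (RingHom.id ℂ) (Lp ℂ 2 μ) (Lp ℂ 2 μ)).comap
    (kernelOperator μ).toLinearMap with hK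
  have hclosed : IsClosed (K : Set C(X × X, ℂ)) :=
    isClosed_setOfPred_isCompactOperator.preimage (kernelOperator μ).continuous
  have hle := Submodule.topologicalClosure_minimal (Submodule.span ℂ
    (Set.range fun p : C(X, ℂ) × C(X, ℂ) => p.1.tensor p.2)) (t := K) (by
      rw [Submodule.span_le]
      rintro _ ⟨p, rfl⟩
      change IsCompactOperator (kernelOperator μ (p.1.tensor p.2))
      rw [kernelOperator_tensor]
      exact isCompactOperator_rankOne _ _) hclosed
  rw [ContinuousMap.topologicalClosure_span_tensor] at hle
  exact hle (Submodule.mem_top (x := h))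

theorem rankOne_mem_closure_range_kernelOperator [T2Space X] [μ.WeaklyRegular]
    (u v : Lp ℂ 2 μ) :
    (InnerProductSpace.rankOne ℂ u v : Lp ℂ 2 μ →L[ℂ] Lp ℂ 2 μ) ∈
      closure (Set.range (kernelOperator μ)) := by
  have hd := ContinuousMap.toLp_denseRange ℂ μ ℂ (p := 2) ENNReal.ofNat_ne_top
  have hc : Continuous fun p : Lp ℂ 2 μ × Lp ℂ 2 μ =>
      (InnerProductSpace.rankOne ℂ p.1 p.2 : Lp ℂ 2 μ →L[ℂ] Lp ℂ 2 μ) :=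
    continuous_rankOne
  refine (hd.prodMap hd).induction_on (p := fun p => (InnerProductSpace.rankOne ℂ p.1 p.2 :
    Lp ℂ 2 μ →L[ℂ] Lp ℂ 2 μ) ∈ closure (Set.range (kernelOperator μ))) (u, v)
    (isClosed_closure.preimage hc) ?_
  rintro ⟨g, f⟩
  refine subset_closure ⟨(star f).tensor g, ?_⟩
  rw [kernelOperator_tensor, star_star]
  rfl

end KernelOperator

/-- For a compact Hausdorff space `X` with a finite regular Borel (Radon) measure `μ` of
full support, the operator-norm closure of the set of integral operators `T_h` with
continuous kernels `h : X × X → ℂ` on `L²(X, μ; ℂ)` is exactly the set of compact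
operators on `L²(X, μ; ℂ)`. -/
theorem closure_integral_operators_eq_compact_operators
    {X : Type*} [TopologicalSpace X] [CompactSpace X] [T2Space X]
    [MeasurableSpace X] [BorelSpace X]
    (μ : Measure X) [IsFiniteMeasure μ] [μ.Regular] [μ.IsOpenPosMeasure] :
    closure {T : Lp ℂ 2 μ →L[ℂ] Lp ℂ 2 μ |
        ∃ h : X × X → ℂ, Continuous h ∧
          ∀ ψ : Lp ℂ 2 μ, (T ψ : X → ℂ) =ᵐ[μ] fun x => ∫ y, h (y, x) * ψ y ∂μ}
      = {T : Lp ℂ 2 μ →L[ℂ] Lp ℂ 2 μ | IsCompactOperator (⇑T)} := by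
  rw [setOf_integral_operators_eq_range_kernelOperator]
  apply subset_antisymm
  · refine closure_minimal ?_ isClosed_setOfPred_isCompactOperator
    rintro _ ⟨h, rfl⟩
    exact isCompactOperator_kernelOperator μ h
  · intro T hT
    have hle : (Submodule.span ℂ (Set.range fun p : Lp ℂ 2 μ × Lp ℂ 2 μ =>
        (InnerProductSpace.rankOne ℂ p.1 p.2 : Lp ℂ 2 μ →L[ℂ] Lp ℂ 2 μ))).topologicalClosure ≤
        (LinearMap.range (kernelOperator μ).toLinearMap).topologicalClosure := by
      refine Submodule.topologicalClosure_minimal _ (Submodule.span_le.2 ?_)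
        (Submodule.isClosed_topologicalClosure _)
      rintro _ ⟨p, rfl⟩
      exact rankOne_mem_closure_range_kernelOperator μ p.1 p.2
    exact hle (IsCompactOperator.mem_topologicalClosure_span_rankOne hT)
end
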